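/- Let 𝕋² = (ℝ/ℤ)² be the flat torus with its quotient metric d and Haar probability measure, and for L ≥ 1 let E_L ⊆ L²(𝕋²) be the linear span of the characters e_{n,m}(x, y) = exp(2πi(nx + my)) over pairs (n, m) ∈ ℤ² with 4π²(n² + m²) ≤ L², with k_L = dim E_L. Then there exists R > 0 such that every triangular family Z = {Z(L)}_{L≥1}, Z(L) = {z_{L1}, …, z_{Lm_L}} ⊂ 𝕋² with m_L ≤ k_L and d(z_{Lj}, z_{Lk}) ≥ R/L for all L ≥ 1 and all j ≠ k, is an L²-interpolating family: for every array of values c_{Lj} (1 ≤ j ≤ m_L, L ≥ 1) with sup_L k_L^{-1} Σ_{j=1}^{m_L} |c_{Lj}|² < ∞, there exist f_L ∈ E_L with sup_L ‖f_L‖_{L²(𝕋²)} < ∞ and f_L(z_{Lj}) = c_{Lj} for all j and L. -/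

import Mathlib

open MeasureTheory Filter

noncomputable section

/-- The flat torus `𝕋² = (ℝ/ℤ)²`, with its product (quotient) metric and Haar
probability measure. -/
abbrev T2 := AddCircle (1 : ℝ) × AddCircle (1 : ℝ)

/-- The character `e_{n,m}(x,y) = exp(2πi(nx+my))` on `𝕋²`. -/
noncomputable def eChar (n m : ℤ) : T2 → ℂ := fun p => fourier n p.1 * fourier m p.2

/-- `E_L`: the span of the characters `e_{n,m}` with `4π²(n²+m²) ≤ L²`,
i.e. of the eigenfunctions of the Laplacian on `𝕋²` with eigenvalue at most `L²`. -/
noncomputable def EL (L : ℝ) : Submodule ℂ (T2 → ℂ) :=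
  Submodule.span ℂ {f | ∃ n m : ℤ,
    4 * Real.pi ^ 2 * ((n : ℝ) ^ 2 + (m : ℝ) ^ 2) ≤ L ^ 2 ∧ f = eChar n m}

/-- `k_L = dim E_L`. -/
noncomputable def kL (L : ℝ) : ℕ := Module.finrank ℂ (EL L)

open scoped ComplexConjugate

theorem eChar_add (n n' m m' : ℤ) (z : T2) :
    eChar (n + n') (m + m') z = eChar n m z * eChar n' m' z := by
  simp only [eChar, fourier_add]; ring

theorem eChar_neg (n m : ℤ) (z : T2) : eChar (-n) (-m) z = conj (eChar n m z) := by
  simp only [eChar, fourier_neg, map_mul]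

theorem eChar_sub_index (n n' m m' : ℤ) (z : T2) :
    eChar (n - n') (m - m') z = eChar n m z * conj (eChar n' m' z) := by
  rw [sub_eq_add_neg, sub_eq_add_neg, eChar_add, eChar_neg]

theorem norm_fourier_apply (n : ℤ) (x : AddCircle (1 : ℝ)) : ‖fourier n x‖ = 1 :=
  Circle.norm_coe _

theorem norm_eChar (n m : ℤ) (z : T2) : ‖eChar n m z‖ = 1 := by
  simp only [eChar, norm_mul, norm_fourier_apply, mul_one]

theorem fourier_sub_point (n : ℤ) (x y : AddCircle (1 : ℝ)) :
    fourier n (x - y) = fourier n x * conj (fourier n y) := by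
  rw [fourier_apply, zsmul_sub, sub_eq_add_neg, AddCircle.toCircle_add, Circle.coe_mul,
    fourier_neg']
  rfl

theorem eChar_sub_point (n m : ℤ) (z w : T2) :
    eChar n m (z - w) = eChar n m z * conj (eChar n m w) := by
  simp only [eChar, Prod.fst_sub, Prod.snd_sub, fourier_sub_point, map_mul]; ring

theorem continuous_eChar (n m : ℤ) : Continuous (eChar n m) := by
  unfold eChar; fun_prop

theorem integral_fourier (n : ℤ) :
    ∫ x : AddCircle (1 : ℝ), fourier n x = if n = 0 then 1 else 0 := by
  split_ifs with h
  · subst h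
    simp [measureReal_def]
  · exact integral_eq_zero_of_add_right_eq_neg (fourier_add_half_inv_index h one_pos)

theorem integral_eChar (n m : ℤ) :
    ∫ z : T2, eChar n m z = if n = 0 ∧ m = 0 then 1 else 0 := by
  unfold eChar
  rw [Measure.volume_eq_prod, integral_prod_mul (fun x => fourier n x) (fun x => fourier m x),
    integral_fourier, integral_fourier]
  split_ifs <;> simp_all

theorem integrable_of_continuous {f : T2 → ℂ} (hf : Continuous f) : Integrable f :=
  hf.integrable_of_hasCompactSupport (HasCompactSupport.of_compactSpace f)

/-- Parseval's identity for trigonometric polynomials on the torus. -/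
theorem integral_norm_sq_sum_eChar (S : Finset (ℤ × ℤ)) (b : ℤ × ℤ → ℂ) :
    ∫ z : T2, ‖∑ p ∈ S, b p * eChar p.1 p.2 z‖ ^ 2 = ∑ p ∈ S, ‖b p‖ ^ 2 := by
  have key : ∫ z : T2, ((‖∑ p ∈ S, b p * eChar p.1 p.2 z‖ ^ 2 : ℝ) : ℂ)
      = ((∑ p ∈ S, ‖b p‖ ^ 2 : ℝ) : ℂ) := by
    have expand : ∀ z : T2, ((‖∑ p ∈ S, b p * eChar p.1 p.2 z‖ ^ 2 : ℝ) : ℂ)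
        = ∑ p ∈ S, ∑ q ∈ S, b p * conj (b q) * eChar (p.1 - q.1) (p.2 - q.2) z := by
      intro z
      rw [Complex.ofReal_pow, ← Complex.mul_conj', map_sum, Finset.sum_mul_sum]
      refine Finset.sum_congr rfl fun p _ => Finset.sum_congr rfl fun q _ => ?_
      rw [eChar_sub_index, map_mul]; ring
    have hint (p q : ℤ × ℤ) : Integrable
        (fun z : T2 => b p * conj (b q) * eChar (p.1 - q.1) (p.2 - q.2) z) :=
      integrable_of_continuous (continuous_const.mul (continuous_eChar _ _))
    simp_rw [expand]
    rw [integral_finsetSum _ fun p _ => integrable_finsetSum _ fun q _ => hint p q]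
    push_cast
    refine Finset.sum_congr rfl fun p hp => ?_
    rw [integral_finsetSum _ fun q _ => hint p q, Finset.sum_eq_single p]
    · rw [integral_const_mul, integral_eChar]
      simp [Complex.mul_conj']
    · intro q _ hq
      rw [integral_const_mul, integral_eChar, if_neg, mul_zero]
      rintro ⟨h1, h2⟩
      exact hq (Prod.ext (by omega) (by omega))
    · exact fun h => absurd hp h
  rw [integral_complex_ofReal] at key
  exact_mod_cast key

/-- If the Gram matrix `K i j = ∑ q, ψ q i * conj (ψ q j)` has constant diagonal `M` and
off-diagonal row sums at most `M / 2`, then the system `∑ q, b q * ψ q i = c i` has a solution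
with `∑ q, ‖b q‖ ^ 2 ≤ 2 / M * ∑ i, ‖c i‖ ^ 2`. -/
theorem exists_solution_of_diagonally_dominant_gram {ι κ : Type*} [Fintype ι] [DecidableEq ι]
    (Q : Finset κ) (ψ : κ → ι → ℂ) {M : ℝ} (hM : 0 < M)
    (hdiag : ∀ i, ∑ q ∈ Q, ψ q i * conj (ψ q i) = M)
    (hoff : ∀ i, ∑ j ∈ Finset.univ.erase i, ‖∑ q ∈ Q, ψ q i * conj (ψ q j)‖ ≤ M / 2)
    (c : ι → ℂ) :
    ∃ b : κ → ℂ, (∀ i, ∑ q ∈ Q, b q * ψ q i = c i) ∧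
      ∑ q ∈ Q, ‖b q‖ ^ 2 ≤ 2 / M * ∑ i, ‖c i‖ ^ 2 := by
  set K : ι → ι → ℂ := fun i j => ∑ q ∈ Q, ψ q i * conj (ψ q j) with hK
  set b : (ι → ℂ) → κ → ℂ := fun a q => ∑ j, a j * conj (ψ q j) with hb
  let T : (ι → ℂ) →ₗ[ℂ] (ι → ℂ) :=
    { toFun := fun a i => ∑ q ∈ Q, b a q * ψ q i
      map_add' := fun a a' => by
        ext i; simp only [hb, Pi.add_apply, add_mul, Finset.sum_add_distrib]
      map_smul' := fun r a => by
        ext i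
        simp only [hb, Pi.smul_apply, smul_eq_mul, RingHom.id_apply, Finset.mul_sum,
          Finset.sum_mul, mul_assoc] }
  have hT (a : ι → ℂ) (i : ι) : T a i = ∑ q ∈ Q, b a q * ψ q i := rfl
  have hTK (a : ι → ℂ) (i : ι) : T a i = ∑ j, a j * K i j := by
    simp only [hT, hb, hK, Finset.sum_mul, Finset.mul_sum]
    rw [Finset.sum_comm]
    exact Finset.sum_congr rfl fun _ _ => Finset.sum_congr rfl fun _ _ => by ring
  have energy (a : ι → ℂ) : ((∑ q ∈ Q, ‖b a q‖ ^ 2 : ℝ) : ℂ) = ∑ i, conj (a i) * T a i := by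
    simp only [hT, Finset.mul_sum]
    rw [Finset.sum_comm]
    push_cast
    refine Finset.sum_congr rfl fun q _ => ?_
    rw [← Complex.mul_conj']
    nth_rewrite 2 [hb]
    simp only [map_sum, map_mul, Complex.conj_conj, Finset.mul_sum]
    exact Finset.sum_congr rfl fun _ _ => by ring
  have hsymm (i j : ι) : ‖K i j‖ = ‖K j i‖ := by
    rw [← RCLike.norm_conj (K i j)]
    simp only [hK, map_sum, map_mul, Complex.conj_conj, mul_comm]
  have coercive (a : ι → ℂ) : M / 2 * ∑ i, ‖a i‖ ^ 2 ≤ ∑ q ∈ Q, ‖b a q‖ ^ 2 := by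
    have hsplit : ((∑ q ∈ Q, ‖b a q‖ ^ 2 : ℝ) : ℂ) = ((M * ∑ i, ‖a i‖ ^ 2 : ℝ) : ℂ) +
        ∑ i, ∑ j ∈ Finset.univ.erase i, conj (a i) * (a j * K i j) := by
      rw [energy]
      push_cast
      rw [Finset.mul_sum, ← Finset.sum_add_distrib]
      refine Finset.sum_congr rfl fun i _ => ?_
      rw [hTK, ← Finset.add_sum_erase _ _ (Finset.mem_univ i), show K i i = M from hdiag i,
        mul_add, Finset.mul_sum, ← Complex.conj_mul']
      congr 1
      ring
    have hbound : ‖∑ i, ∑ j ∈ Finset.univ.erase i, conj (a i) * (a j * K i j)‖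
        ≤ M / 2 * ∑ i, ‖a i‖ ^ 2 := by
      have h1 : ‖∑ i, ∑ j ∈ Finset.univ.erase i, conj (a i) * (a j * K i j)‖
          ≤ ∑ i, ∑ j ∈ Finset.univ.erase i,
            (‖a i‖ ^ 2 / 2 * ‖K i j‖ + ‖a j‖ ^ 2 / 2 * ‖K j i‖) := by
        refine norm_sum_le_of_le _ fun i _ => norm_sum_le_of_le _ fun j _ => ?_
        rw [norm_mul, norm_mul, RCLike.norm_conj, hsymm j i]
        nlinarith [mul_nonneg (sq_nonneg (‖a i‖ - ‖a j‖)) (norm_nonneg (K i j))]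
      have h2 : ∑ i, ∑ j ∈ Finset.univ.erase i, ‖a j‖ ^ 2 / 2 * ‖K j i‖
          = ∑ i, ∑ j ∈ Finset.univ.erase i, ‖a i‖ ^ 2 / 2 * ‖K i j‖ := by
        refine Finset.sum_comm' fun i j => ?_
        simp [eq_comm]
      have h3 : ∑ i, ∑ j ∈ Finset.univ.erase i, ‖a i‖ ^ 2 / 2 * ‖K i j‖
          ≤ ∑ i, ‖a i‖ ^ 2 / 2 * (M / 2) := by
        refine Finset.sum_le_sum fun i _ => ?_
        rw [← Finset.mul_sum]
        exact mul_le_mul_of_nonneg_left (hoff i) (by positivity)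
      simp only [Finset.sum_add_distrib] at h1
      rw [h2] at h1
      rw [← Finset.sum_mul, ← Finset.sum_div] at h3
      linarith
    have hnorm := congrArg Complex.re hsplit
    rw [Complex.add_re, Complex.ofReal_re, Complex.ofReal_re] at hnorm
    have := (abs_le.1 ((Complex.abs_re_le_norm _).trans hbound)).1
    linarith
  have hinj : Function.Injective T := by
    rw [← LinearMap.ker_eq_bot, LinearMap.ker_eq_bot']
    intro a ha
    have h0 : ∑ q ∈ Q, ‖b a q‖ ^ 2 = 0 := by
      have := energy a
      rw [ha] at this
      simpa only [Pi.zero_apply, mul_zero, Finset.sum_const_zero, Complex.ofReal_eq_zero] using this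
    have h1 : ∑ i, ‖a i‖ ^ 2 ≤ 0 := by
      have := coercive a
      rw [h0] at this
      exact nonpos_of_mul_nonpos_right this (by positivity)
    have h2 := (Finset.sum_eq_zero_iff_of_nonneg fun i _ => sq_nonneg ‖a i‖).1
      (le_antisymm h1 (Finset.sum_nonneg fun i _ => sq_nonneg _))
    ext i
    simpa using h2 i (Finset.mem_univ i)
  obtain ⟨a, rfl⟩ := LinearMap.injective_iff_surjective.1 hinj c
  refine ⟨b a, fun i => rfl, ?_⟩
  have hupper : ∑ q ∈ Q, ‖b a q‖ ^ 2
      ≤ ∑ i, (M / 4 * ‖a i‖ ^ 2 + 1 / M * ‖T a i‖ ^ 2) := by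
    have h1 : ∑ q ∈ Q, ‖b a q‖ ^ 2 = ‖∑ i, conj (a i) * T a i‖ := by
      rw [← energy, Complex.norm_real, Real.norm_of_nonneg (by positivity)]
    rw [h1]
    refine norm_sum_le_of_le _ fun i _ => ?_
    rw [norm_mul, RCLike.norm_conj]
    have : M / 4 * ‖a i‖ ^ 2 + 1 / M * ‖T a i‖ ^ 2 - ‖a i‖ * ‖T a i‖
        = (M * ‖a i‖ / 2 - ‖T a i‖) ^ 2 / M := by field_simp; ring
    have : 0 ≤ (M * ‖a i‖ / 2 - ‖T a i‖) ^ 2 / M := by positivity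
    linarith
  rw [Finset.sum_add_distrib, ← Finset.mul_sum, ← Finset.mul_sum] at hupper
  have := coercive a
  rw [show 2 / M = 2 * (1 / M) by ring]
  linarith

theorem exists_real_representative (x : AddCircle (1 : ℝ)) :
    ∃ t : ℝ, (t : AddCircle (1 : ℝ)) = x ∧ |t| = ‖x‖ := by
  induction x using QuotientAddGroup.induction_on with
  | H s =>
    refine ⟨s - round s, ?_, (UnitAddCircle.norm_eq (x := s)).symm⟩
    rw [AddCircle.coe_sub, sub_eq_self, AddCircle.coe_eq_zero_iff]
    exact ⟨round s, by simp⟩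

/-- The one-dimensional one-sided Dirichlet kernel. -/
def dirichletSum (N : ℕ) (x : AddCircle (1 : ℝ)) : ℂ := ∑ n ∈ Finset.range N, fourier (n : ℤ) x

theorem norm_dirichletSum_le (N : ℕ) (x : AddCircle (1 : ℝ)) : ‖dirichletSum N x‖ ≤ N := by
  refine (norm_sum_le _ _).trans ?_
  simp only [norm_fourier_apply, Finset.sum_const, Finset.card_range, nsmul_eq_mul, mul_one,
    le_refl]

theorem four_mul_norm_le_norm_fourier_one_sub_one (x : AddCircle (1 : ℝ)) :
    4 * ‖x‖ ≤ ‖fourier 1 x - 1‖ := by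
  obtain ⟨t, rfl, ht⟩ := exists_real_representative x
  have hhalf : |t| ≤ 1 / 2 := by
    rw [ht]; simpa using AddCircle.norm_le_half_period 1 one_ne_zero (x := (t : AddCircle (1 : ℝ)))
  rw [← ht, fourier_coe_apply]
  have harg : 2 * (Real.pi : ℂ) * Complex.I * ((1 : ℤ) : ℂ) * t / ((1 : ℝ) : ℂ)
      = Complex.I * ((2 * Real.pi * t : ℝ) : ℂ) := by
    push_cast; ring
  have habs : |Real.pi * t| = Real.pi * |t| := by rw [abs_mul, abs_of_pos Real.pi_pos]
  have hsin := Real.mul_abs_le_abs_sin (x := Real.pi * t) (by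
    rw [habs]; nlinarith [Real.pi_pos])
  rw [habs, ← mul_assoc, div_mul_cancel₀ _ Real.pi_ne_zero] at hsin
  rw [harg, Complex.norm_exp_I_mul_ofReal_sub_one, norm_mul, Real.norm_eq_abs, Real.norm_eq_abs,
    abs_two, show 2 * Real.pi * t / 2 = Real.pi * t by ring]
  linarith

theorem norm_dirichletSum_mul_le (N : ℕ) (x : AddCircle (1 : ℝ)) :
    ‖dirichletSum N x‖ * (2 * ‖x‖) ≤ 1 := by
  have hpow (n : ℕ) : fourier (n : ℤ) x = fourier 1 x ^ n := by
    induction n with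
    | zero => rw [Nat.cast_zero, fourier_zero, pow_zero]
    | succ k ih => rw [Nat.cast_succ, fourier_add, ih, pow_succ]
  have hgeom : ‖dirichletSum N x‖ * ‖fourier 1 x - 1‖ ≤ 2 := by
    rw [← norm_mul, dirichletSum, Finset.sum_congr rfl fun n _ => hpow n, geom_sum_mul, ← hpow]
    refine (norm_sub_le _ _).trans ?_
    rw [norm_fourier_apply, norm_one]; norm_num
  have := mul_le_mul_of_nonneg_left (four_mul_norm_le_norm_fourier_one_sub_one x)
    (norm_nonneg (dirichletSum N x))
  linarith

/-- A summable weight on `ℤ` controlling the squared Dirichlet kernel on unit cells. -/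
def cellWeight (a : ℤ) : ℝ := 2 / (1 + (a : ℝ) ^ 2)

theorem cellWeight_nonneg (a : ℤ) : 0 ≤ cellWeight a := by unfold cellWeight; positivity

theorem summable_cellWeight : Summable cellWeight := by
  have h1 : Summable fun a : ℤ => 2 * (1 / (a : ℝ) ^ 2) :=
    (Real.summable_one_div_int_pow.2 one_lt_two).mul_left 2
  refine h1.of_norm_bounded_eventually ?_
  rw [Filter.eventually_cofinite]
  refine (Set.finite_singleton (0 : ℤ)).subset fun a ha => ?_
  by_contra h0
  refine ha ?_
  have : (0 : ℝ) < (a : ℝ) ^ 2 := by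
    have : (a : ℝ) ≠ 0 := by exact_mod_cast h0
    positivity
  rw [Real.norm_of_nonneg (cellWeight_nonneg a), cellWeight, ← mul_div_assoc, mul_one]
  gcongr
  linarith

theorem one_le_cellWeight_floor {s : ℝ} (hs : |s| < 1) : 1 ≤ cellWeight ⌊s⌋ := by
  obtain ⟨h1, h2⟩ := abs_lt.1 hs
  have h3 : (-1 : ℤ) ≤ ⌊s⌋ := Int.le_floor.2 (by push_cast; linarith)
  have h4 : ⌊s⌋ < 1 := Int.floor_lt.2 (by simpa using h2)
  have h5 : (-1 : ℝ) ≤ ⌊s⌋ := by exact_mod_cast h3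
  have h6 : (⌊s⌋ : ℝ) ≤ 0 := by exact_mod_cast Int.lt_add_one_iff.1 h4
  rw [cellWeight, le_div_iff₀ (by positivity)]
  nlinarith

theorem one_le_cellWeight_floor_mul {s : ℝ} (hs : 1 ≤ |s|) :
    1 ≤ cellWeight ⌊s⌋ * (4 * s ^ 2) := by
  have h1 := Int.floor_le s
  have h2 := Int.lt_floor_add_one s
  have h3 : |(⌊s⌋ : ℝ)| ≤ 2 * |s| := by
    have : |(⌊s⌋ : ℝ) - s| ≤ 1 := abs_le.2 ⟨by linarith, by linarith⟩
    have := abs_sub_abs_le_abs_sub (⌊s⌋ : ℝ) s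
    linarith
  have h4 : (⌊s⌋ : ℝ) ^ 2 ≤ 4 * s ^ 2 := by
    rw [← sq_abs (⌊s⌋ : ℝ), ← sq_abs s]
    nlinarith [abs_nonneg (⌊s⌋ : ℝ)]
  have h5 : 1 ≤ s ^ 2 := by rw [← sq_abs s]; nlinarith
  rw [cellWeight, div_mul_eq_mul_div, le_div_iff₀ (by positivity)]
  linarith

/-- Bounds on the squared Dirichlet kernel in terms of the cell of side `ρ / N` containing `t`. -/
theorem norm_dirichletSum_sq_le {N : ℕ} (hN : 0 < N) {ρ : ℝ} (hρ : 1 ≤ ρ) {t : ℝ}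
    {x : AddCircle (1 : ℝ)} (ht : |t| = ‖x‖) :
    ‖dirichletSum N x‖ ^ 2 ≤ (N : ℝ) ^ 2 * cellWeight ⌊N * t / ρ⌋ ∧
    (ρ / N ≤ ‖x‖ →
      ‖dirichletSum N x‖ ^ 2 ≤ (N : ℝ) ^ 2 * cellWeight ⌊N * t / ρ⌋ / ρ ^ 2) := by
  have hN' : (0 : ℝ) < N := by exact_mod_cast hN
  have hρ0 : 0 < ρ := by linarith
  set s := N * t / ρ with hs
  have habs : |s| = N * ‖x‖ / ρ := by
    rw [hs, abs_div, abs_mul, Nat.abs_cast, abs_of_pos hρ0, ht]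
  have hfar (h : ρ / N ≤ ‖x‖) :
      ‖dirichletSum N x‖ ^ 2 ≤ (N : ℝ) ^ 2 * cellWeight ⌊s⌋ / ρ ^ 2 := by
    have h1 : 1 ≤ |s| := by
      rw [habs, le_div_iff₀ hρ0, one_mul]
      rw [div_le_iff₀ hN'] at h; linarith
    have h2 := one_le_cellWeight_floor_mul h1
    have hx : 0 < ‖x‖ := lt_of_lt_of_le (by positivity) h
    have h3 : (‖dirichletSum N x‖ * (2 * ‖x‖)) ^ 2 ≤ 1 :=
      pow_le_one₀ (by positivity) (norm_dirichletSum_mul_le N x)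
    have h4 : (N : ℝ) ^ 2 * cellWeight ⌊s⌋ / ρ ^ 2 * (2 * ‖x‖) ^ 2
        = cellWeight ⌊s⌋ * (4 * s ^ 2) := by
      rw [← sq_abs s, habs]; ring
    refine le_of_mul_le_mul_right ?_ (show 0 < (2 * ‖x‖) ^ 2 by positivity)
    rw [h4, ← mul_pow]
    exact h3.trans h2
  refine ⟨?_, hfar⟩
  rcases le_or_gt (ρ / N) ‖x‖ with h | h
  · refine (hfar h).trans (div_le_self ?_ (one_le_pow₀ hρ))
    exact mul_nonneg (by positivity) (cellWeight_nonneg _)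
  · have h1 : |s| < 1 := by
      rw [habs, div_lt_one hρ0]
      rw [lt_div_iff₀ hN'] at h; linarith
    calc ‖dirichletSum N x‖ ^ 2 ≤ (N : ℝ) ^ 2 * 1 := by
          rw [mul_one]; gcongr; exact norm_dirichletSum_le N x
      _ ≤ _ := by gcongr; exact one_le_cellWeight_floor h1

theorem norm_sub_lt_of_floor_eq {N : ℕ} (hN : 0 < N) {ρ : ℝ} (hρ : 0 < ρ) {s t : ℝ}
    (h : ⌊N * s / ρ⌋ = ⌊N * t / ρ⌋) :
    ‖(s : AddCircle (1 : ℝ)) - (t : AddCircle (1 : ℝ))‖ < ρ / N := by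
  have hN' : (0 : ℝ) < N := by exact_mod_cast hN
  have h1 := Int.abs_sub_lt_one_of_floor_eq_floor h
  rw [← AddCircle.coe_sub]
  refine lt_of_le_of_lt (b := |s - t|) ?_ ?_
  · rw [UnitAddCircle.norm_eq]
    simpa using round_le (s - t) 0
  · rw [← sub_div, ← mul_sub, abs_div, abs_mul, Nat.abs_cast, abs_of_pos hρ, div_lt_one hρ] at h1
    rw [lt_div_iff₀ hN']; linarith

/-- The off-diagonal sum of the squared two-dimensional Dirichlet kernel over a
`ρ / N`-separated family is `O(N ^ 4 / ρ ^ 2)`. -/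
theorem exists_sum_dirichletSum_le :
    ∃ C : ℝ, 0 < C ∧ ∀ {ι : Type} (S : Finset ι) (w : ι → T2) (N : ℕ) (ρ : ℝ), 0 < N → 1 ≤ ρ →
      (∀ j ∈ S, ρ / N ≤ ‖w j‖) →
      (∀ j ∈ S, ∀ k ∈ S, j ≠ k → ρ / N ≤ dist (w j) (w k)) →
      ∑ j ∈ S, (‖dirichletSum N (w j).1‖ * ‖dirichletSum N (w j).2‖) ^ 2
        ≤ C * (N : ℝ) ^ 4 / ρ ^ 2 := by
  have hsum : Summable fun p : ℤ × ℤ => cellWeight p.1 * cellWeight p.2 :=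
    summable_cellWeight.mul_of_nonneg summable_cellWeight cellWeight_nonneg cellWeight_nonneg
  have hnonneg (p : ℤ × ℤ) : 0 ≤ cellWeight p.1 * cellWeight p.2 :=
    mul_nonneg (cellWeight_nonneg _) (cellWeight_nonneg _)
  refine ⟨∑' p : ℤ × ℤ, cellWeight p.1 * cellWeight p.2 + 1,
    add_pos_of_nonneg_of_pos (tsum_nonneg hnonneg) one_pos, ?_⟩
  intro ι S w N ρ hN hρ hfar hsep
  classical
  have hρ0 : 0 < ρ := by linarith
  choose r hr hrabs using exists_real_representative
  set cell : ι → ℤ × ℤ := fun j => (⌊N * r (w j).1 / ρ⌋, ⌊N * r (w j).2 / ρ⌋) with hcell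
  have hinj : Set.InjOn cell S := by
    intro j hj k hk hjk
    by_contra hne
    have h1 := norm_sub_lt_of_floor_eq hN hρ0 (congrArg Prod.fst hjk)
    have h2 := norm_sub_lt_of_floor_eq hN hρ0 (congrArg Prod.snd hjk)
    rw [hr, hr] at h1 h2
    refine absurd (hsep j hj k hk hne) (not_le.2 ?_)
    rw [dist_eq_norm, Prod.norm_def]
    exact max_lt h1 h2
  have hterm (j : ι) (hj : j ∈ S) :
      (‖dirichletSum N (w j).1‖ * ‖dirichletSum N (w j).2‖) ^ 2
        ≤ (N : ℝ) ^ 4 / ρ ^ 2 * (cellWeight (cell j).1 * cellWeight (cell j).2) := by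
    obtain ⟨h1, h1'⟩ := norm_dirichletSum_sq_le hN hρ (hrabs (w j).1)
    obtain ⟨h2, h2'⟩ := norm_dirichletSum_sq_le hN hρ (hrabs (w j).2)
    have hw1 := cellWeight_nonneg ⌊N * r (w j).1 / ρ⌋
    have hw2 := cellWeight_nonneg ⌊N * r (w j).2 / ρ⌋
    rw [mul_pow]
    rcases le_max_iff.1 ((hfar j hj).trans_eq (Prod.norm_def (w j))) with h | h
    · refine (mul_le_mul (h1' h) h2 (by positivity) (by positivity)).trans_eq ?_
      simp only [hcell]; ring
    · refine (mul_le_mul h1 (h2' h) (by positivity) (by positivity)).trans_eq ?_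
      simp only [hcell]; ring
  calc _ ≤ ∑ j ∈ S, (N : ℝ) ^ 4 / ρ ^ 2 * (cellWeight (cell j).1 * cellWeight (cell j).2) :=
        Finset.sum_le_sum hterm
    _ = (N : ℝ) ^ 4 / ρ ^ 2 * ∑ p ∈ S.image cell, cellWeight p.1 * cellWeight p.2 := by
        rw [← Finset.mul_sum, Finset.sum_image hinj]
    _ ≤ (N : ℝ) ^ 4 / ρ ^ 2 * (∑' p : ℤ × ℤ, cellWeight p.1 * cellWeight p.2 + 1) := by
        gcongr
        linarith [hsum.sum_le_tsum (S.image cell) fun p _ => hnonneg p]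
    _ = _ := by ring

/-- The frequencies `(n, m)` with `0 ≤ n, m < N`. -/
def freqBox (N : ℕ) : Finset (ℤ × ℤ) :=
  (Finset.range N).map Nat.castEmbedding ×ˢ (Finset.range N).map Nat.castEmbedding

theorem card_freqBox (N : ℕ) : (freqBox N).card = N ^ 2 := by
  simp [freqBox, sq]

theorem sum_freqBox_eChar (N : ℕ) (z : T2) :
    ∑ p ∈ freqBox N, eChar p.1 p.2 z = dirichletSum N z.1 * dirichletSum N z.2 := by
  simp only [freqBox, eChar, Finset.sum_product, Finset.sum_map, dirichletSum, Finset.sum_mul_sum,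
    Nat.castEmbedding_apply]

theorem eChar_sub_mem_EL {N : ℕ} {L : ℝ} (hN : (N : ℝ) ≤ L / 10 + 1)
    {p p' : ℤ × ℤ} (hp : p ∈ freqBox N) (hp' : p' ∈ freqBox N) :
    eChar (p.1 - p'.1) (p.2 - p'.2) ∈ EL L := by
  refine Submodule.subset_span ⟨_, _, ?_, rfl⟩
  simp only [freqBox, Finset.mem_product, Finset.mem_map, Finset.mem_range,
    Nat.castEmbedding_apply] at hp hp'
  obtain ⟨⟨a, ha, ha'⟩, b, hb, hb'⟩ := hp
  obtain ⟨⟨c, hc, hc'⟩, d, hd, hd'⟩ := hp'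
  rw [← ha', ← hb', ← hc', ← hd']
  have hsq (i j : ℕ) (hi : i < N) (hj : j < N) :
      ((((i : ℤ) - (j : ℤ) : ℤ) : ℝ)) ^ 2 ≤ L ^ 2 / 100 := by
    have h1 : (i : ℝ) + 1 ≤ N := by exact_mod_cast hi
    have h2 : (j : ℝ) + 1 ≤ N := by exact_mod_cast hj
    have h3 : (0 : ℝ) ≤ i := Nat.cast_nonneg i
    have h4 : (0 : ℝ) ≤ j := Nat.cast_nonneg j
    push_cast
    rw [show L ^ 2 / 100 = (L / 10) ^ 2 by ring]
    exact sq_le_sq' (by linarith) (by linarith)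
  have h1 := hsq a c ha hc
  have h2 := hsq b d hb hd
  have hpi : Real.pi ^ 2 ≤ 10 := by nlinarith [Real.pi_lt_d2, Real.pi_pos]
  calc _ ≤ 4 * 10 * (L ^ 2 / 100 + L ^ 2 / 100) := by gcongr
    _ ≤ L ^ 2 := by nlinarith

theorem kL_le {L : ℝ} (hL : 1 ≤ L) : (kL L : ℝ) ≤ 9 * L ^ 2 := by
  classical
  set k : ℕ := ⌊L⌋₊ with hk
  set S : Finset (T2 → ℂ) := (Finset.Icc (-(k : ℤ)) k ×ˢ Finset.Icc (-(k : ℤ)) k).image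
    fun p => eChar p.1 p.2 with hS
  have habs (n : ℤ) (h : (n : ℝ) ^ 2 ≤ L ^ 2) : n ∈ Finset.Icc (-(k : ℤ)) k := by
    rw [Finset.mem_Icc, ← abs_le, hk, Int.natCast_floor_eq_floor (by linarith), Int.le_floor]
    push_cast
    exact abs_le_of_sq_le_sq h (by linarith)
  have hsub : {f | ∃ n m : ℤ, 4 * Real.pi ^ 2 * ((n : ℝ) ^ 2 + (m : ℝ) ^ 2) ≤ L ^ 2 ∧
      f = eChar n m} ⊆ (S : Set (T2 → ℂ)) := by
    rintro f ⟨n, m, h, rfl⟩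
    have hpi : 1 ≤ 4 * Real.pi ^ 2 := by nlinarith [Real.pi_gt_three]
    have h' : (n : ℝ) ^ 2 + (m : ℝ) ^ 2 ≤ L ^ 2 :=
      (le_mul_of_one_le_left (by positivity) hpi).trans h
    refine Finset.mem_coe.2 (Finset.mem_image.2 ⟨(n, m), Finset.mem_product.2 ⟨?_, ?_⟩, rfl⟩)
    · exact habs n (by nlinarith [sq_nonneg (m : ℝ)])
    · exact habs m (by nlinarith [sq_nonneg (n : ℝ)])
  have hfin : Module.Finite ℂ (Submodule.span ℂ (S : Set (T2 → ℂ))) :=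
    FiniteDimensional.span_finset ℂ S
  have h1 : kL L ≤ S.card :=
    (Submodule.finrank_mono (Submodule.span_mono hsub)).trans (finrank_span_finset_le_card S)
  have h2 : S.card ≤ (2 * k + 1) ^ 2 := by
    refine Finset.card_image_le.trans_eq ?_
    rw [Finset.card_product, Int.card_Icc, sq,
      show ((k : ℤ) + 1 - -(k : ℤ)).toNat = 2 * k + 1 by omega]
  have h3 : (kL L : ℝ) ≤ (2 * k + 1) ^ 2 := by exact_mod_cast h1.trans h2
  have h4 : (k : ℝ) ≤ L := Nat.floor_le (by linarith)
  calc (kL L : ℝ) ≤ (2 * k + 1) ^ 2 := h3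
    _ ≤ (3 * L) ^ 2 := by gcongr; linarith
    _ = 9 * L ^ 2 := by ring

/-- A trigonometric sum over frequency differences has `L²` norm controlled by its coefficients. -/
theorem integral_norm_sq_sum_eChar_sub_le (N : ℕ) (b : (ℤ × ℤ) × (ℤ × ℤ) → ℂ) :
    ∫ z : T2, ‖∑ q ∈ freqBox N ×ˢ freqBox N,
        b q * eChar (q.1.1 - q.2.1) (q.1.2 - q.2.2) z‖ ^ 2
      ≤ (N : ℝ) ^ 2 * ∑ q ∈ freqBox N ×ˢ freqBox N, ‖b q‖ ^ 2 := by
  set F : ℤ × ℤ → T2 → ℝ := fun p' z => ‖∑ p ∈ freqBox N, b (p, p') * eChar p.1 p.2 z‖ ^ 2 with hF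
  have hint (p' : ℤ × ℤ) : Integrable (F p') := by
    have hcont : Continuous (F p') := by
      refine (continuous_finsetSum _ fun p _ => ?_).norm.pow 2
      exact continuous_const.mul (continuous_eChar _ _)
    exact hcont.integrable_of_hasCompactSupport (HasCompactSupport.of_compactSpace _)
  have hpoint (z : T2) : ‖∑ q ∈ freqBox N ×ˢ freqBox N,
      b q * eChar (q.1.1 - q.2.1) (q.1.2 - q.2.2) z‖ ^ 2
        ≤ (N : ℝ) ^ 2 * ∑ p' ∈ freqBox N, F p' z := by
    have h1 : ‖∑ q ∈ freqBox N ×ˢ freqBox N, b q * eChar (q.1.1 - q.2.1) (q.1.2 - q.2.2) z‖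
        ≤ ∑ p' ∈ freqBox N, ‖∑ p ∈ freqBox N, b (p, p') * eChar p.1 p.2 z‖ := by
      rw [Finset.sum_product_right]
      refine norm_sum_le_of_le _ fun p' _ => le_of_eq ?_
      simp only [eChar_sub_index, ← mul_assoc]
      rw [← Finset.sum_mul, norm_mul, RCLike.norm_conj, norm_eChar, mul_one]
    refine (pow_le_pow_left₀ (norm_nonneg _) h1 2).trans (sq_sum_le_card_mul_sum_sq.trans_eq ?_)
    rw [card_freqBox, Nat.cast_pow]
  calc _ ≤ ∫ z : T2, (N : ℝ) ^ 2 * ∑ p' ∈ freqBox N, F p' z :=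
        integral_mono_of_nonneg (.of_forall fun _ => by positivity)
          ((integrable_finsetSum _ fun p' _ => hint p').const_mul _) (.of_forall hpoint)
    _ = _ := by
        rw [integral_const_mul, integral_finsetSum _ fun p' _ => hint p', Finset.sum_product_right]
        congr 1
        exact Finset.sum_congr rfl fun p' _ =>
          integral_norm_sq_sum_eChar (freqBox N) fun p => b (p, p')

/-- The interpolation statement at a single level `L`, with a quantitative norm bound. -/
theorem exists_interpolant :
    ∃ R : ℝ, 0 < R ∧ ∀ L : ℝ, 1 ≤ L → ∀ (m : ℕ) (z : Fin m → T2),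
      (∀ j i, j ≠ i → R / L ≤ dist (z j) (z i)) → ∀ c : Fin m → ℂ,
        ∃ f ∈ EL L, ∫ p : T2, ‖f p‖ ^ 2 ≤ 200 / L ^ 2 * ∑ j, ‖c j‖ ^ 2 ∧ ∀ j, f (z j) = c j := by
  obtain ⟨C, hC, hsum⟩ := exists_sum_dirichletSum_le
  set ρ := 1 + 2 * C with hρ
  have hρ1 : 1 ≤ ρ := by linarith
  refine ⟨10 * ρ, by linarith, fun L hL m z hsep c => ?_⟩
  set N : ℕ := ⌊L / 10⌋₊ + 1 with hNdef
  have hN : 0 < N := Nat.succ_pos _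
  have hN0 : (0 : ℝ) < N := by exact_mod_cast hN
  have hNle : (N : ℝ) ≤ L / 10 + 1 := by
    rw [hNdef]; push_cast
    linarith [Nat.floor_le (show 0 ≤ L / 10 by linarith)]
  have hNge : L / 10 ≤ N := by
    rw [hNdef]; push_cast
    exact (Nat.lt_floor_add_one _).le
  have hsepN (j i : Fin m) (h : j ≠ i) : ρ / N ≤ dist (z j) (z i) := by
    refine le_trans ?_ (hsep j i h)
    rw [div_le_div_iff₀ hN0 (by linarith)]
    nlinarith
  set ψ : (ℤ × ℤ) × (ℤ × ℤ) → Fin m → ℂ := fun q i =>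
    eChar (q.1.1 - q.2.1) (q.1.2 - q.2.2) (z i) with hψ
  have hgram (i j : Fin m) : ∑ q ∈ freqBox N ×ˢ freqBox N, ψ q i * conj (ψ q j)
      = (((‖dirichletSum N (z i - z j).1‖ * ‖dirichletSum N (z i - z j).2‖) ^ 2 : ℝ) : ℂ) := by
    simp only [hψ, ← eChar_sub_point]
    simp only [eChar_sub_index, Finset.sum_product, ← Finset.mul_sum]
    rw [← Finset.sum_mul, ← map_sum, sum_freqBox_eChar, Complex.mul_conj', norm_mul]
    push_cast; rfl
  obtain ⟨b, hb, hbnorm⟩ := exists_solution_of_diagonally_dominant_gram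
    (freqBox N ×ˢ freqBox N) ψ (M := (N : ℝ) ^ 4) (by positivity) (fun i => by
      rw [hgram, sub_self]
      congr 1
      simp only [dirichletSum, Prod.fst_zero, Prod.snd_zero, fourier_eval_zero, Finset.sum_const,
        Finset.card_range, nsmul_eq_mul, mul_one, Complex.norm_natCast]
      ring) (fun i => by
      simp only [hgram, Complex.norm_real, Real.norm_of_nonneg (sq_nonneg _)]
      refine (hsum (Finset.univ.erase i) (fun j => z i - z j) N ρ hN hρ1 ?_ ?_).trans ?_
      · intro j hj
        rw [← dist_eq_norm]
        exact hsepN i j (Finset.ne_of_mem_erase hj).symm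
      · intro j _ k _ hjk
        rw [dist_sub_left]
        exact hsepN j k hjk
      · rw [div_le_div_iff₀ (by positivity) two_pos]
        have : 2 * C ≤ ρ ^ 2 := by nlinarith
        nlinarith [show (0 : ℝ) ≤ (N : ℝ) ^ 4 by positivity]) c
  refine ⟨fun p => ∑ q ∈ freqBox N ×ˢ freqBox N, b q * eChar (q.1.1 - q.2.1) (q.1.2 - q.2.2) p,
    ?_, ?_, hb⟩
  · have : (fun p => ∑ q ∈ freqBox N ×ˢ freqBox N,
        b q * eChar (q.1.1 - q.2.1) (q.1.2 - q.2.2) p)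
        = ∑ q ∈ freqBox N ×ˢ freqBox N, b q • eChar (q.1.1 - q.2.1) (q.1.2 - q.2.2) := by
      ext p; simp only [Finset.sum_apply, Pi.smul_apply, smul_eq_mul]
    rw [this]
    refine Submodule.sum_mem _ fun q hq => Submodule.smul_mem _ _ ?_
    exact eChar_sub_mem_EL hNle (Finset.mem_product.1 hq).1 (Finset.mem_product.1 hq).2
  · have hS : 0 ≤ ∑ j, ‖c j‖ ^ 2 := by positivity
    calc _ ≤ (N : ℝ) ^ 2 * (2 / (N : ℝ) ^ 4 * ∑ j, ‖c j‖ ^ 2) :=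
          (integral_norm_sq_sum_eChar_sub_le N b).trans (by gcongr)
      _ = 2 / (N : ℝ) ^ 2 * ∑ j, ‖c j‖ ^ 2 := by field_simp
      _ ≤ 2 / (L / 10) ^ 2 * ∑ j, ‖c j‖ ^ 2 := by gcongr
      _ = 200 / L ^ 2 * ∑ j, ‖c j‖ ^ 2 := by ring

/-- **Sufficiently separated families on the flat torus are interpolating.**
There exists `R > 0` such that every triangular family `Z(L) = {z L 0, …, z L (m L−1)}`
with `m L ≤ k_L` and pairwise distances at least `R/L` is an `L²`-interpolating family
for the spaces `E_L`. -/
theorem stmt_19 :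
    ∃ R : ℝ, 0 < R ∧ ∀ (m : ℝ → ℕ) (z : ℝ → ℕ → T2),
      (∀ L : ℝ, 1 ≤ L → m L ≤ kL L) →
      (∀ L : ℝ, 1 ≤ L → ∀ j < m L, ∀ i < m L, j ≠ i →
        R / L ≤ dist (z L j) (z L i)) →
      ∀ c : ℝ → ℕ → ℂ,
        (∃ B : ℝ, ∀ L : ℝ, 1 ≤ L →
          (kL L : ℝ)⁻¹ * ∑ j ∈ Finset.range (m L), ‖c L j‖ ^ 2 ≤ B) →
        ∃ f : ℝ → T2 → ℂ,
          (∀ L : ℝ, 1 ≤ L → f L ∈ EL L) ∧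
          (∃ B : ℝ, ∀ L : ℝ, 1 ≤ L → ∫ p : T2, ‖f L p‖ ^ 2 ≤ B) ∧
          (∀ L : ℝ, 1 ≤ L → ∀ j < m L, f L (z L j) = c L j) := by
  obtain ⟨R, hR, hinterp⟩ := exists_interpolant
  refine ⟨R, hR, fun m z hm hsep c ⟨B, hB⟩ => ?_⟩
  have hlevel (L : ℝ) : ∃ f : T2 → ℂ, 1 ≤ L → f ∈ EL L ∧ ∫ p : T2, ‖f p‖ ^ 2 ≤ 1800 * |B| ∧
      ∀ j < m L, f (z L j) = c L j := by
    by_cases hL : 1 ≤ L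
    swap
    · exact ⟨0, fun h => absurd h hL⟩
    obtain ⟨f, hf, hnorm, hval⟩ := hinterp L hL (m L) (fun j => z L j)
      (fun j i hji => hsep L hL j j.2 i i.2 (Fin.val_ne_of_ne hji)) (fun j => c L j)
    refine ⟨f, fun _ => ⟨hf, hnorm.trans ?_, fun j hj => hval ⟨j, hj⟩⟩⟩
    rw [Fin.sum_univ_eq_sum_range fun j => ‖c L j‖ ^ 2]
    have hdata : ∑ j ∈ Finset.range (m L), ‖c L j‖ ^ 2 ≤ kL L * |B| := by
      rcases Nat.eq_zero_or_pos (kL L) with h0 | hpos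
      · rw [Nat.le_zero.1 ((hm L hL).trans_eq h0), Finset.range_zero, Finset.sum_empty]
        positivity
      · have hpos' : (0 : ℝ) < kL L := by exact_mod_cast hpos
        rw [← inv_mul_le_iff₀ hpos']
        exact (hB L hL).trans (le_abs_self B)
    have hL0 : 0 < L := by linarith
    calc 200 / L ^ 2 * ∑ j ∈ Finset.range (m L), ‖c L j‖ ^ 2
        ≤ 200 / L ^ 2 * (9 * L ^ 2 * |B|) := by
          gcongr
          exact hdata.trans (by gcongr; exact kL_le hL)
      _ = 1800 * |B| := by field_simp; ring
  choose f hf using hlevel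
  exact ⟨f, fun L hL => (hf L hL).1, ⟨1800 * |B|, fun L hL => (hf L hL).2.1⟩,
    fun L hL => (hf L hL).2.2⟩

end
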